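/- arXiv:2405.18173 — 3 statements merged into one kernel-verified Lean document; each statement's English description precedes it below -/
import Mathlib

section
/- Let G=(V,E,ω,μ) be a finite connected weighted graph, let p>1, and let ψ:V→[0,∞) with min_{x∈V} ψ(x) > 0. Then 1/((p-1)(max_{V} ψ)^{p-1}) ≤ liminf_{λ→0} λ^{p-1} T_λ ≤ limsup_{λ→0} λ^{p-1} T_λ ≤ 1/((p-1)(min_{V} ψ)^{p-1}). -/
open Filter Topology Set
open scoped ENNReal Classical

noncomputable section

/-- The graph Laplacian `Δu(x) = (1/μ(x)) ∑_y ω(x,y) (u(y) − u(x))`. -/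
def graphLap {V : Type*} (ω : V → V → ℝ) (μ : V → ℝ) (u : V → ℝ) (x : V) : ℝ :=
  (1 / μ x) * ∑' y, ω x y * (u y - u x)

/-- `(V, ω, μ)` is a locally finite connected weighted graph: `ω` is symmetric and
nonnegative (with `ω x y > 0` exactly for neighbours), there are no loops, every
vertex has finitely many neighbours, `μ > 0`, and the graph is connected. -/
structure IsWeightedGraph {V : Type*} (ω : V → V → ℝ) (μ : V → ℝ) : Prop where
  symm : ∀ x y, ω x y = ω y x
  nonneg : ∀ x y, 0 ≤ ω x y
  loopless : ∀ x, ω x x = 0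
  locallyFinite : ∀ x, {y | 0 < ω x y}.Finite
  measurePos : ∀ x, 0 < μ x
  connected : ∀ x y, Relation.ReflTransGen (fun a b => 0 < ω a b) x y

/-- `D_μ = sup_x m(x)/μ(x) < ∞`, where `m(x) = ∑_{y ∼ x} ω(x,y)`. -/
def DmuFinite {V : Type*} (ω : V → V → ℝ) (μ : V → ℝ) : Prop :=
  ∃ C : ℝ, ∀ x, (∑' y, ω x y) ≤ C * μ x

/-- A solution of `u_t = L u + u^p` on `V × [0,T)` with initial datum `ψ0`:
a nonnegative function, continuous in `t` on `[0,T)` for each fixed `x`,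
bounded on `V × [0,T']` for every `T' < T`, differentiable in `t` on `(0,T)`
and satisfying the equation pointwise there. -/
structure IsHeatSol {V : Type*} (L : (V → ℝ) → V → ℝ) (p : ℝ)
    (ψ0 : V → ℝ) (T : ℝ) (u : V → ℝ → ℝ) : Prop where
  nonneg : ∀ x, ∀ t ∈ Ico (0:ℝ) T, 0 ≤ u x t
  cont : ∀ x, ContinuousOn (u x) (Ico (0:ℝ) T)
  bounded : ∀ T' ∈ Ioo (0:ℝ) T, ∃ C : ℝ, ∀ x, ∀ t ∈ Icc (0:ℝ) T', |u x t| ≤ C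
  eqn : ∀ x, ∀ t ∈ Ioo (0:ℝ) T,
    HasDerivAt (u x) (L (fun y => u y t) x + u x t ^ p) t
  init : ∀ x, u x 0 = ψ0 x

/-- The life span `T_λ`: the supremum (in `ℝ≥0∞`) of all `T > 0` such that the
problem has a solution on `[0,T)`. -/
def lifeSpan {V : Type*} (L : (V → ℝ) → V → ℝ) (p : ℝ) (ψ0 : V → ℝ) : ℝ≥0∞ :=
  ⨆ (T : ℝ) (_ : 0 < T ∧ ∃ u, IsHeatSol L p ψ0 T u), ENNReal.ofReal T

theorem graphLap_eq_sum {V : Type*} [Fintype V] (ω : V → V → ℝ) (μ : V → ℝ) (u : V → ℝ) (x : V) :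
    graphLap ω μ u x = (1 / μ x) * ∑ y, ω x y * (u y - u x) := by
  rw [graphLap, tsum_fintype]

theorem graphLap_nonneg_of_forall_le {V : Type*} [Fintype V] {ω : V → V → ℝ} {μ : V → ℝ}
    (hG : IsWeightedGraph ω μ) {u : V → ℝ} {x : V} (h : ∀ y, u x ≤ u y) :
    0 ≤ graphLap ω μ u x := by
  rw [graphLap_eq_sum]
  have := hG.measurePos x
  exact mul_nonneg (by positivity)
    (Finset.sum_nonneg fun y _ => mul_nonneg (hG.nonneg x y) (sub_nonneg.2 (h y)))

theorem graphLap_nonpos_of_forall_le {V : Type*} [Fintype V] {ω : V → V → ℝ} {μ : V → ℝ}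
    (hG : IsWeightedGraph ω μ) {u : V → ℝ} {x : V} (h : ∀ y, u y ≤ u x) :
    graphLap ω μ u x ≤ 0 := by
  rw [graphLap_eq_sum]
  have := hG.measurePos x
  exact mul_nonpos_of_nonneg_of_nonpos (by positivity)
    (Finset.sum_nonpos fun y _ => mul_nonpos_of_nonneg_of_nonpos (hG.nonneg x y)
      (sub_nonpos.2 (h y)))

/-- A function starting nonpositive whose derivative is nonpositive wherever the function is
positive stays nonpositive. -/
theorem nonpos_of_deriv_nonpos_of_pos {f f' : ℝ → ℝ} {T : ℝ}
    (hf : ∀ t ∈ Icc 0 T, HasDerivWithinAt f (f' t) (Icc 0 T) t) (h0 : f 0 ≤ 0)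
    (h : ∀ t ∈ Icc 0 T, 0 < f t → f' t ≤ 0) : ∀ t ∈ Icc 0 T, f t ≤ 0 := by
  intro t ht
  have key : ∀ ε > 0, f t ≤ ε * (1 + t) := by
    intro ε hε
    refine image_le_of_deriv_right_lt_deriv_boundary' (f := f) (f' := f') (a := 0) (b := T)
      (B := fun s => ε * (1 + s)) (B' := fun _ => ε)
      (fun s hs => (hf s hs).continuousWithinAt) ?_ ?_ (by fun_prop) ?_ ?_ ht
    · intro s hs
      exact (hf s ⟨hs.1, hs.2.le⟩).mono_of_mem_nhdsWithin (Icc_mem_nhdsGE_of_mem hs)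
    · simp only [add_zero, mul_one]; linarith
    · intro s _
      have := (((hasDerivAt_id s).const_add 1).const_mul ε).hasDerivWithinAt (s := Ici s)
      simpa using this
    · intro s hs hfs
      have h1 : 0 < f s := by
        rw [hfs]
        have := hs.1
        positivity
      exact (h s ⟨hs.1, hs.2.le⟩ h1).trans_lt hε
  have ht1 : 0 < 1 + t := by linarith [ht.1]
  refine le_of_forall_pos_le_add fun ε hε => ?_
  have := key (ε / (1 + t)) (by positivity)
  rwa [div_mul_cancel₀ _ ht1.ne', ← zero_add ε] at this

/-- The positive solution of `z' = (b / (p - 1)) z ^ p` blowing up at time `a / b`. -/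
def powBarrier (a b p t : ℝ) : ℝ := (a - b * t) ^ (-(1 / (p - 1)))

theorem powBarrier_pos {a b t : ℝ} (p : ℝ) (h : 0 < a - b * t) : 0 < powBarrier a b p t :=
  Real.rpow_pos_of_pos h _

theorem hasDerivAt_powBarrier {a b p t : ℝ} (hp : 1 < p) (h : 0 < a - b * t) :
    HasDerivAt (powBarrier a b p) (b / (p - 1) * powBarrier a b p t ^ p) t := by
  have h1 : HasDerivAt (fun s => a - b * s) (-b) t := by
    simpa using ((hasDerivAt_id t).const_mul b).const_sub a
  have h2 := h1.rpow_const (p := -(1 / (p - 1))) (Or.inl h.ne')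
  have hp' : p - 1 ≠ 0 := by linarith
  have he : -(1 / (p - 1)) - 1 = -(1 / (p - 1)) * p := by field_simp; ring
  have h3 : b / (p - 1) * powBarrier a b p t ^ p
      = -b * -(1 / (p - 1)) * (a - b * t) ^ (-(1 / (p - 1)) - 1) := by
    rw [powBarrier, ← Real.rpow_mul h.le, he]
    ring
  rw [h3]
  exact h2

theorem powBarrier_zero {M b p : ℝ} (hp : 1 < p) (hM : 0 < M) :
    powBarrier (M ^ (-(p - 1))) b p 0 = M := by
  have hp' : p - 1 ≠ 0 := by linarith
  rw [powBarrier, mul_zero, sub_zero, ← Real.rpow_mul hM.le]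
  have : -(p - 1) * -(1 / (p - 1)) = 1 := by field_simp
  rw [this, Real.rpow_one]

theorem IsHeatSol.le_of_strict_subsolution {V : Type*} [Fintype V] {ω : V → V → ℝ} {μ : V → ℝ}
    (hG : IsWeightedGraph ω μ) {p T S : ℝ} (hST : S < T) {ψ0 : V → ℝ} {u : V → ℝ → ℝ}
    (hu : IsHeatSol (graphLap ω μ) p ψ0 T u) {y y' : ℝ → ℝ}
    (hy : ∀ t ∈ Icc 0 S, HasDerivAt y (y' t) t) (hlt : ∀ t ∈ Icc 0 S, y' t < y t ^ p)
    (h0 : ∀ x, y 0 < ψ0 x) : ∀ t ∈ Icc 0 S, ∀ x, y t ≤ u x t := by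
  have hcont : ∀ x, ContinuousOn (fun t => u x t - y t) (Icc 0 S) := fun x =>
    ((hu.cont x).mono fun t ht => ⟨ht.1, ht.2.trans_lt hST⟩).sub
      fun t ht => (hy t ht).continuousAt.continuousWithinAt
  suffices Icc 0 S ⊆ {t | ∀ x, 0 ≤ u x t - y t} from fun t ht x => sub_nonneg.1 (this ht x)
  refine IsClosed.Icc_subset_of_forall_exists_gt ?_ ?_ ?_
  · have : {t | ∀ x, 0 ≤ u x t - y t} ∩ Icc 0 S
        = Icc 0 S ∩ ⋂ x, (Icc 0 S ∩ (fun t => u x t - y t) ⁻¹' Ici 0) := by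
      ext t
      simp only [mem_inter_iff, mem_ofPred_eq, mem_iInter, mem_preimage, mem_Ici]
      exact ⟨fun h => ⟨h.2, fun x => ⟨h.2, h.1 x⟩⟩, fun h => ⟨fun x => (h.2 x).2, h.1⟩⟩
    rw [this]
    exact isClosed_Icc.inter (isClosed_iInter fun x =>
      (hcont x).preimage_isClosed_of_isClosed isClosed_Icc isClosed_Ici)
  · intro x
    rw [hu.init]
    exact sub_nonneg.2 (h0 x).le
  · rintro t ⟨htS, ht⟩ r hr
    have htI : t ∈ Icc 0 S := ⟨ht.1, ht.2.le⟩
    have hev : ∀ᶠ s in 𝓝[>] t, ∀ x, 0 ≤ u x s - y s := by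
      rw [eventually_all]
      intro x
      rcases (htS x).lt_or_eq with hpos | heq
      · have h1 : Tendsto (fun s => u x s - y s) (𝓝[>] t) (𝓝 (u x t - y t)) :=
          (hcont x t htI).mono_left (nhdsWithin_le_of_mem (mem_of_superset
            (Ioc_mem_nhdsGT ht.2) fun s hs => ⟨ht.1.trans hs.1.le, hs.2⟩))
        exact (h1.eventually (lt_mem_nhds hpos)).mono fun s hs => hs.le
      · have ht0 : 0 < t := by
          rcases ht.1.lt_or_eq with h | h
          · exact h
          · rw [← h, hu.init] at heq
            linarith [h0 x]
        have hux : u x t = y t := by linarith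
        have hd := (hu.eqn x t ⟨ht0, ht.2.trans hST⟩).sub (hy t htI)
        have hlap : 0 ≤ graphLap ω μ (fun z => u z t) x :=
          graphLap_nonneg_of_forall_le hG fun z => by
            have := htS z
            linarith
        have hdpos : 0 < graphLap ω μ (fun z => u z t) x + u x t ^ p - y' t := by
          rw [hux]; linarith [hlt t htI]
        have hs := (hasDerivAt_iff_tendsto_slope.1 hd).mono_left
          (nhdsWithin_mono t (fun s hs => ne_of_gt hs : Ioi t ⊆ {t}ᶜ))
        filter_upwards [hs.eventually (lt_mem_nhds hdpos), self_mem_nhdsWithin] with s hs1 hs2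
        have hs2 : t < s := hs2
        rw [slope_def_field] at hs1
        have := (div_pos_iff_of_pos_right (sub_pos.2 hs2)).1 hs1
        simp only [Pi.sub_apply] at this
        linarith
    obtain ⟨s, hs1, hs2⟩ := (hev.and (Ioc_mem_nhdsGT hr)).exists
    exact ⟨s, hs1, hs2⟩

theorem IsHeatSol.le_blowup_time {V : Type*} [Fintype V] [Nonempty V] {ω : V → V → ℝ} {μ : V → ℝ}
    (hG : IsWeightedGraph ω μ) {p T m : ℝ} (hp : 1 < p) (hm : 0 < m) (hT : 0 < T) {ψ0 : V → ℝ}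
    {u : V → ℝ → ℝ} (hu : IsHeatSol (graphLap ω μ) p ψ0 T u) (h0 : ∀ x, m ≤ ψ0 x) :
    T ≤ m ^ (-(p - 1)) / (p - 1) := by
  by_contra! hlt
  have hp' : 0 < p - 1 := by linarith
  rw [div_lt_iff₀ hp'] at hlt
  have hmp : 0 < m ^ (-(p - 1)) := Real.rpow_pos_of_pos hm _
  obtain ⟨a, ha1, ha2⟩ := exists_between hlt
  have ha : 0 < a := hmp.trans ha1
  obtain ⟨b, hb1, hb2⟩ := exists_between ((div_lt_iff₀' hT).2 ha2)
  have hb : 0 < b := (div_pos ha hT).trans hb1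
  have habT : a / b < T := by
    rw [div_lt_iff₀ hT] at hb1
    rw [div_lt_iff₀ hb]; linarith
  have hpos : ∀ t < a / b, 0 < a - b * t := by
    intro t ht
    rw [lt_div_iff₀ hb] at ht; linarith
  have hy0 : powBarrier a b p 0 < m := by
    have : powBarrier a b p 0 < powBarrier (m ^ (-(p - 1))) b p 0 := by
      simp only [powBarrier, mul_zero, sub_zero]
      exact Real.rpow_lt_rpow_of_neg hmp ha1 (by simpa using hp')
    rwa [powBarrier_zero hp hm] at this
  obtain ⟨C, hC⟩ := hu.bounded (a / b) ⟨by positivity, habT⟩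
  have hle : ∀ t ∈ Ico 0 (a / b), powBarrier a b p t ≤ C := by
    intro t ht
    obtain ⟨x⟩ := ‹Nonempty V›
    have hcmp := hu.le_of_strict_subsolution hG (ht.2.trans habT) (y := powBarrier a b p)
      (fun s hs => hasDerivAt_powBarrier hp (hpos s (hs.2.trans_lt ht.2)))
      (fun s hs => ?_) (fun x => hy0.trans_le (h0 x)) t ⟨ht.1, le_rfl⟩ x
    · exact hcmp.trans ((le_abs_self _).trans (hC x t ⟨ht.1, ht.2.le⟩))
    · have := Real.rpow_pos_of_pos (powBarrier_pos p (hpos s (hs.2.trans_lt ht.2))) p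
      exact mul_lt_of_lt_one_left this ((div_lt_one hp').2 hb2)
  have htend : Tendsto (powBarrier a b p) (𝓝[<] (a / b)) atTop := by
    have h1 : Tendsto (fun t => a - b * t) (𝓝[<] (a / b)) (𝓝[>] 0) := by
      refine tendsto_nhdsWithin_iff.2 ⟨?_, ?_⟩
      · have : Continuous fun t => a - b * t := by fun_prop
        have h2 := (this.tendsto (a / b)).mono_left (nhdsWithin_le_nhds (s := Iio (a / b)))
        rwa [mul_div_cancel₀ _ hb.ne', sub_self] at h2
      · filter_upwards [self_mem_nhdsWithin] with t ht using hpos t ht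
    exact (tendsto_rpow_neg_nhdsGT_zero (by simpa using hp')).comp h1
  obtain ⟨t, ht1, ht2⟩ := ((htend.eventually (eventually_gt_atTop C)).and
    (Ico_mem_nhdsLT (show (0 : ℝ) < a / b by positivity))).exists
  exact absurd (hle t ht2) (not_le.2 ht1)

/-- The reaction-diffusion vector field. -/
def heatField {V : Type*} (ω : V → V → ℝ) (μ : V → ℝ) (p : ℝ) (v : V → ℝ) : V → ℝ :=
  fun x => graphLap ω μ v x + v x ^ p

theorem contDiff_heatField {V : Type*} [Fintype V] (ω : V → V → ℝ) (μ : V → ℝ) {p : ℝ}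
    (hp : 1 < p) : ContDiff ℝ 1 (heatField ω μ p) := by
  rw [contDiff_pi]
  intro x
  simp only [heatField, graphLap_eq_sum]
  have h : ContDiff ℝ (1 : ℕ) fun v : V → ℝ => v x ^ p :=
    (contDiff_apply ℝ ℝ x).rpow_const_of_le (by exact_mod_cast hp.le)
  refine ContDiff.add ?_ (by exact_mod_cast h)
  fun_prop

/-- Coordinatewise truncation to the interval `[0, c]`. -/
def clampFun {V : Type*} (c : ℝ) (v : V → ℝ) : V → ℝ := fun x => max 0 (min c (v x))

theorem lipschitzWith_clampFun {V : Type*} [Fintype V] (c : ℝ) :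
    LipschitzWith 1 (clampFun c : (V → ℝ) → V → ℝ) := by
  refine LipschitzWith.of_dist_le_mul fun v w => ?_
  rw [NNReal.coe_one, one_mul, dist_pi_le_iff dist_nonneg]
  intro x
  have h : LipschitzWith 1 fun r : ℝ => max 0 (min c r) :=
    (LipschitzWith.id.const_min c).const_max 0
  have h1 := h.dist_le_mul (v x) (w x)
  rw [NNReal.coe_one, one_mul] at h1
  exact h1.trans (dist_le_pi_dist v w x)

theorem exists_isHeatSol_of_supersolution {V : Type*} [Fintype V] {ω : V → V → ℝ} {μ : V → ℝ}
    (hG : IsWeightedGraph ω μ) {p T : ℝ} (hp : 1 < p) (hT : 0 < T) {ψ0 : V → ℝ} {z : ℝ → ℝ}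
    (hz : ∀ t ∈ Icc 0 T, HasDerivAt z (z t ^ p) t) (hzpos : ∀ t ∈ Icc 0 T, 0 < z t)
    (h0 : ∀ x, 0 ≤ ψ0 x) (h1 : ∀ x, ψ0 x ≤ z 0) :
    ∃ u, IsHeatSol (graphLap ω μ) p ψ0 T u := by
  have hzc : ContinuousOn z (Icc 0 T) := fun t ht => (hz t ht).continuousAt.continuousWithinAt
  obtain ⟨M, hM⟩ := isCompact_Icc.exists_bound_of_continuousOn hzc
  have hM' : ∀ t ∈ Icc 0 T, z t ≤ M := fun t ht => (le_abs_self _).trans (hM t ht)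
  have hM0 : 0 ≤ M := (norm_nonneg _).trans (hM 0 ⟨le_rfl, hT.le⟩)
  have hsmooth := contDiff_heatField ω μ hp
  have hbox : IsCompact (Icc (fun _ => 0 : V → ℝ) fun _ => M) := isCompact_Icc
  obtain ⟨K, hK⟩ := hsmooth.contDiffOn.exists_lipschitzOnWith one_ne_zero
    (convex_Icc (fun _ => 0 : V → ℝ) fun _ => M) hbox
  obtain ⟨L, hL⟩ := hbox.exists_bound_of_continuousOn hsmooth.continuous.continuousOn
  have hmem : ∀ t ∈ Icc 0 T, ∀ v : V → ℝ,
      clampFun (z t) v ∈ Icc (fun _ => 0 : V → ℝ) fun _ => M := fun t ht v =>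
    ⟨fun x => le_max_left _ _, fun x => max_le hM0 ((min_le_left _ _).trans (hM' t ht))⟩
  have hPL : IsPicardLindelof (fun t v => heatField ω μ p (clampFun (z t) v))
      (⟨0, le_rfl, hT.le⟩ : Icc (0 : ℝ) T) ψ0 (L.toNNReal * T.toNNReal) 0 L.toNNReal K := by
    refine ⟨fun t ht => ?_, fun v _ => ?_, fun t ht v _ => ?_, ?_⟩
    · have := hK.comp ((lipschitzWith_clampFun (V := V) (z t)).lipschitzOnWith (s := univ))
        (fun v _ => hmem t ht v)
      rw [mul_one] at this
      exact this.mono (subset_univ _)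
    · refine hsmooth.continuous.comp_continuousOn (continuousOn_pi.2 fun x => ?_)
      exact ContinuousOn.sup continuousOn_const (hzc.inf continuousOn_const)
    · exact (hL _ (hmem t ht v)).trans (Real.le_coe_toNNReal L)
    · simp [hT.le]
  obtain ⟨α, hα0, hα⟩ := hPL.exists_eq_forall_mem_Icc_hasDerivWithinAt₀
  simp only at hα0
  have hαx : ∀ x, ∀ t ∈ Icc 0 T, HasDerivWithinAt (fun s => α s x)
      (heatField ω μ p (clampFun (z t) (α t)) x) (Icc 0 T) t := fun x t ht =>
    hasDerivWithinAt_pi.1 (hα t ht) x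
  have hnonneg : ∀ x, ∀ t ∈ Icc 0 T, 0 ≤ α t x := by
    intro x t ht
    refine neg_nonpos.1 (nonpos_of_deriv_nonpos_of_pos (fun s hs => (hαx x s hs).fun_neg)
      (by simpa [hα0] using h0 x) (fun s hs hneg => ?_) t ht)
    have hx0 : clampFun (z s) (α s) x = 0 :=
      max_eq_left ((min_le_right _ _).trans (by linarith))
    have hlap : 0 ≤ graphLap ω μ (clampFun (z s) (α s)) x :=
      graphLap_nonneg_of_forall_le hG fun y => by
        rw [hx0]
        exact le_max_left _ _
    have hpow : 0 ≤ clampFun (z s) (α s) x ^ p := Real.rpow_nonneg hx0.ge p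
    rw [heatField]
    linarith
  have hle : ∀ x, ∀ t ∈ Icc 0 T, α t x ≤ z t := by
    intro x t ht
    refine sub_nonpos.1 (nonpos_of_deriv_nonpos_of_pos
      (fun s hs => (hαx x s hs).fun_sub (hz s hs).hasDerivWithinAt)
      (by simpa [hα0] using h1 x) (fun s hs hpos => ?_) t ht)
    have hxz : clampFun (z s) (α s) x = z s := by
      rw [clampFun, min_eq_left (by linarith), max_eq_right (hzpos s hs).le]
    have hlap : graphLap ω μ (clampFun (z s) (α s)) x ≤ 0 :=
      graphLap_nonpos_of_forall_le hG fun y => by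
        rw [hxz]
        exact max_le (hzpos s hs).le (min_le_left _ _)
    rw [heatField, hxz]
    linarith
  have hclamp : ∀ t ∈ Icc 0 T, clampFun (z t) (α t) = α t := by
    intro t ht
    funext x
    rw [clampFun, min_eq_right (hle x t ht), max_eq_right (hnonneg x t ht)]
  refine ⟨fun x t => α t x, ⟨fun x t ht => hnonneg x t ⟨ht.1, ht.2.le⟩, fun x t ht => ?_,
    fun T' hT' => ⟨M, fun x t ht => ?_⟩, fun x t ht => ?_, fun x => by rw [hα0]⟩⟩
  · exact ((hαx x t ⟨ht.1, ht.2.le⟩).continuousWithinAt).mono Ico_subset_Icc_self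
  · have htI : t ∈ Icc 0 T := ⟨ht.1, ht.2.trans hT'.2.le⟩
    rw [abs_of_nonneg (hnonneg x t htI)]
    exact (hle x t htI).trans (hM' t htI)
  · have htI : t ∈ Icc 0 T := ⟨ht.1.le, ht.2.le⟩
    have := (hαx x t htI).hasDerivAt (Icc_mem_nhds ht.1 ht.2)
    rwa [hclamp t htI] at this

theorem lifeSpan_le {V : Type*} [Fintype V] [Nonempty V] {ω : V → V → ℝ} {μ : V → ℝ}
    (hG : IsWeightedGraph ω μ) {p m : ℝ} (hp : 1 < p) (hm : 0 < m) {ψ0 : V → ℝ}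
    (h0 : ∀ x, m ≤ ψ0 x) :
    lifeSpan (graphLap ω μ) p ψ0 ≤ ENNReal.ofReal (m ^ (-(p - 1)) / (p - 1)) := by
  refine iSup₂_le fun T hT => ENNReal.ofReal_le_ofReal ?_
  obtain ⟨hT0, u, hu⟩ := hT
  exact hu.le_blowup_time hG hp hm hT0 h0

theorem le_lifeSpan {V : Type*} [Fintype V] {ω : V → V → ℝ} {μ : V → ℝ}
    (hG : IsWeightedGraph ω μ) {p M : ℝ} (hp : 1 < p) (hM : 0 < M) {ψ0 : V → ℝ}
    (h0 : ∀ x, 0 ≤ ψ0 x) (h1 : ∀ x, ψ0 x ≤ M) :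
    ENNReal.ofReal (M ^ (-(p - 1)) / (p - 1)) ≤ lifeSpan (graphLap ω μ) p ψ0 := by
  have hp' : 0 < p - 1 := by linarith
  have hMp : 0 < M ^ (-(p - 1)) := Real.rpow_pos_of_pos hM _
  refine le_of_forall_lt fun c hc => ?_
  obtain ⟨r, -, hcr, hr⟩ := ENNReal.lt_iff_exists_real_btwn.1 hc
  have hr0 : 0 < r := ENNReal.ofReal_pos.1 (bot_le.trans_lt hcr)
  have hr1 : r < M ^ (-(p - 1)) / (p - 1) := (ENNReal.ofReal_lt_ofReal_iff (by positivity)).1 hr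
  rw [lt_div_iff₀ hp'] at hr1
  have hpos : ∀ t ∈ Icc 0 r, 0 < M ^ (-(p - 1)) - (p - 1) * t := fun t ht => by
    nlinarith [ht.2]
  refine hcr.trans_le (le_iSup₂_of_le r ⟨hr0, ?_⟩ le_rfl)
  refine exists_isHeatSol_of_supersolution hG hp hr0
    (z := powBarrier (M ^ (-(p - 1))) (p - 1) p) (fun t ht => ?_)
    (fun t ht => powBarrier_pos p (hpos t ht)) h0 (fun x => by rw [powBarrier_zero hp hM]; exact h1 x)
  simpa [div_self hp'.ne'] using hasDerivAt_powBarrier hp (hpos t ht)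

theorem rpow_mul_blowup_time {p l m : ℝ} (hl : 0 < l) (hm : 0 < m) :
    ENNReal.ofReal (l ^ (p - 1)) * ENNReal.ofReal ((l * m) ^ (-(p - 1)) / (p - 1)) =
      ENNReal.ofReal (1 / ((p - 1) * m ^ (p - 1))) := by
  have hlp := Real.rpow_pos_of_pos hl (p - 1)
  rw [← ENNReal.ofReal_mul hlp.le, Real.rpow_neg (by positivity), Real.mul_rpow hl.le hm.le]
  congr 1
  field_simp

/-- Theorem 1.7(3): on a finite connected weighted graph, if `min_V ψ > 0` then
`1/((p-1)(max_V ψ)^{p-1}) ≤ liminf_{λ→0} λ^{p-1} T_λ ≤ limsup_{λ→0} λ^{p-1} T_λ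
 ≤ 1/((p-1)(min_V ψ)^{p-1})`. -/
theorem stmt7 {V : Type*} [Fintype V] [Nonempty V]
    (ω : V → V → ℝ) (μ : V → ℝ) (hG : IsWeightedGraph ω μ)
    (p : ℝ) (hp : 1 < p)
    (ψ : V → ℝ) (hψ0 : ∀ x, 0 ≤ ψ x) (hmin : 0 < ⨅ x, ψ x) :
    ENNReal.ofReal (1 / ((p - 1) * (⨆ x, ψ x) ^ (p - 1))) ≤
        liminf (fun lam : ℝ => ENNReal.ofReal (lam ^ (p - 1)) *
          lifeSpan (graphLap ω μ) p (fun x => lam * ψ x)) (𝓝[>] (0:ℝ)) ∧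
      liminf (fun lam : ℝ => ENNReal.ofReal (lam ^ (p - 1)) *
          lifeSpan (graphLap ω μ) p (fun x => lam * ψ x)) (𝓝[>] (0:ℝ)) ≤
        limsup (fun lam : ℝ => ENNReal.ofReal (lam ^ (p - 1)) *
          lifeSpan (graphLap ω μ) p (fun x => lam * ψ x)) (𝓝[>] (0:ℝ)) ∧
      limsup (fun lam : ℝ => ENNReal.ofReal (lam ^ (p - 1)) *
          lifeSpan (graphLap ω μ) p (fun x => lam * ψ x)) (𝓝[>] (0:ℝ)) ≤
        ENNReal.ofReal (1 / ((p - 1) * (⨅ x, ψ x) ^ (p - 1))) := by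
  have hbdd : BddBelow (range ψ) := (finite_range ψ).bddBelow
  have hbdd' : BddAbove (range ψ) := (finite_range ψ).bddAbove
  have hmle : ∀ x, (⨅ x, ψ x) ≤ ψ x := fun x => ciInf_le hbdd x
  have hleM : ∀ x, ψ x ≤ ⨆ x, ψ x := fun x => le_ciSup hbdd' x
  obtain ⟨x₀⟩ := ‹Nonempty V›
  have hmax : 0 < ⨆ x, ψ x := hmin.trans_le ((hmle x₀).trans (hleM x₀))
  refine ⟨le_liminf_of_le (by isBoundedDefault) ?_, liminf_le_limsup,
    limsup_le_of_le (by isBoundedDefault) ?_⟩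
  · filter_upwards [self_mem_nhdsWithin] with l hl
    have hl : 0 < l := hl
    rw [← rpow_mul_blowup_time hl hmax]
    gcongr
    exact le_lifeSpan hG hp (by positivity) (fun x => mul_nonneg hl.le (hψ0 x))
      fun x => mul_le_mul_of_nonneg_left (hleM x) hl.le
  · filter_upwards [self_mem_nhdsWithin] with l hl
    have hl : 0 < l := hl
    rw [← rpow_mul_blowup_time hl hmin]
    gcongr
    exact lifeSpan_le hG hp (by positivity)
      fun x => mul_le_mul_of_nonneg_left (hmle x) hl.le
end
end

section
/- Let G=(V,E,ω,μ) be an infinite, locally finite, connected weighted graph with D_μ<∞, and let T∈(0,∞]. Suppose c and z are bounded on V×I for every bounded interval I⊂[0,T), z(x,·) is continuous on [0,T) and differentiable on (0,T) for each x∈V, and z satisfies z_t − Δz − c(x,t)z ≥ 0 on V×(0,T) and z(x,0) ≥ 0 for all x∈V. Then z ≥ 0 on V×(0,T). -/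
open Filter Topology Set
open scoped ENNReal Classical

noncomputable section

/-- At vertices of a locally finite graph the Laplacian is bounded below by
`(m(x)/μ(x)) (b − u(x))` for every lower bound `b` of `u`. -/
theorem IsWeightedGraph.le_graphLap {V : Type*} {ω : V → V → ℝ} {μ : V → ℝ}
    (hG : IsWeightedGraph ω μ) {u : V → ℝ} {b : ℝ} (hb : ∀ y, b ≤ u y) (x : V) :
    (∑' y, ω x y) / μ x * (b - u x) ≤ graphLap ω μ u x := by
  have hsupp (v : V → ℝ) : Summable fun y => ω x y * v y := by
    refine summable_of_hasFiniteSupport ((hG.locallyFinite x).subset fun y hy => ?_)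
    exact lt_of_le_of_ne (hG.nonneg x y) (Ne.symm (left_ne_zero_of_mul hy))
  have hle : (∑' y, ω x y) * (b - u x) ≤ ∑' y, ω x y * (u y - u x) := by
    rw [← tsum_mul_right]
    exact (hsupp fun _ => b - u x).tsum_le_tsum
      (fun y => mul_le_mul_of_nonneg_left (by linarith [hb y]) (hG.nonneg x y))
      (hsupp fun y => u y - u x)
  have hμ := hG.measurePos x
  calc (∑' y, ω x y) / μ x * (b - u x) = 1 / μ x * ((∑' y, ω x y) * (b - u x)) := by ring
    _ ≤ graphLap ω μ u x := mul_le_mul_of_nonneg_left hle (by positivity)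

/-- The derivative is nonpositive at a positive minimum point of a function on `[0, s]`. -/
theorem HasDerivAt.nonpos_of_isMinOn_Icc {f : ℝ → ℝ} {f' s t : ℝ} (ht : t ∈ Icc 0 s)
    (ht0 : 0 < t) (hmin : IsMinOn f (Icc 0 s) t) (hf : HasDerivAt f f' t) : f' ≤ 0 := by
  have hmem : (0 : ℝ) - t ∈ posTangentConeAt (Icc 0 s) t :=
    sub_mem_posTangentConeAt_of_segment_subset
      ((convex_Icc 0 s).segment_subset ht ⟨le_rfl, ht.1.trans ht.2⟩)
  have h := hmin.localize.hasFDerivWithinAt_nonneg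
    hf.hasFDerivAt.hasFDerivWithinAt hmem
  simp at h
  nlinarith

/-- A lower bound `-A e^{λt}` for a supersolution with nonnegative initial data improves to
`-(A/2) e^{λt}` as soon as `λ ≥ C + 2D + 1`, where `c ≤ C` and `m ≤ D μ`. -/
theorem IsWeightedGraph.halve_lower_bound {V : Type*} {ω : V → V → ℝ} {μ : V → ℝ}
    (hG : IsWeightedGraph ω μ) {C D s : ℝ} (hD0 : 0 ≤ D) (hD : ∀ x, (∑' y, ω x y) ≤ D * μ x)
    {c z z' : V → ℝ → ℝ} (hc : ∀ x, ∀ t ∈ Icc 0 s, c x t ≤ C)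
    (hcont : ∀ x, ContinuousOn (z x) (Icc 0 s))
    (hderiv : ∀ x, ∀ t ∈ Ioc 0 s, HasDerivAt (z x) (z' x t) t)
    (hineq : ∀ x, ∀ t ∈ Ioc 0 s,
      0 ≤ z' x t - graphLap ω μ (fun y => z y t) x - c x t * z x t)
    (hinit : ∀ x, 0 ≤ z x 0) {A : ℝ} (hA : 0 ≤ A)
    (hlow : ∀ x, ∀ t ∈ Icc 0 s, -A ≤ Real.exp (-(C + 2 * D + 1) * t) * z x t) :
    ∀ x, ∀ t ∈ Icc 0 s, -(A / 2) ≤ Real.exp (-(C + 2 * D + 1) * t) * z x t := by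
  intro x t ht
  set l := C + 2 * D + 1 with hl
  obtain ⟨r, hr, hmin⟩ := isCompact_Icc.exists_isMinOn ⟨t, ht⟩
    (f := fun t => Real.exp (-l * t) * z x t)
    (ContinuousOn.mul (by fun_prop) (hcont x))
  refine le_trans ?_ (hmin ht)
  change -(A / 2) ≤ Real.exp (-l * r) * z x r
  by_contra! hneg
  have hz : z x r < 0 := by
    by_contra! h
    have := mul_nonneg (Real.exp_pos (-l * r)).le h
    linarith
  have hr0 : 0 < r := by
    refine lt_of_le_of_ne hr.1 fun h => ?_
    rw [← h] at hz
    exact absurd (hinit x) (not_le.mpr hz)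
  have hexp : HasDerivAt (fun t => Real.exp (-l * t)) (Real.exp (-l * r) * -l) r := by
    simpa using ((hasDerivAt_id r).const_mul (-l)).exp
  have hd := HasDerivAt.nonpos_of_isMinOn_Icc hr hr0 hmin (hexp.mul (hderiv x r ⟨hr0, hr.2⟩))
  have hz' : z' x r ≤ l * z x r := by
    have : Real.exp (-l * r) * (z' x r - l * z x r) ≤ 0 := by linarith
    linarith [nonpos_of_mul_nonpos_right this (Real.exp_pos _)]
  set E := A * Real.exp (l * r) with hE
  have hee : Real.exp (l * r) * Real.exp (-l * r) = 1 := by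
    rw [← Real.exp_add]; simp
  have hscale (v : ℝ) : Real.exp (l * r) * (Real.exp (-l * r) * v) = v := by
    rw [← mul_assoc, hee, one_mul]
  have hEz : ∀ y, -E ≤ z y r := fun y => by
    have := mul_le_mul_of_nonneg_left (hlow y r hr) (Real.exp_pos (l * r)).le
    rw [hscale] at this
    linarith
  have hzE : z x r < -(E / 2) := by
    have := mul_lt_mul_of_pos_left hneg (Real.exp_pos (l * r))
    rw [hscale] at this
    linarith
  have hE0 : 0 ≤ E := by positivity
  have hμ := hG.measurePos x
  have hlap := hG.le_graphLap (u := fun y => z y r) hEz x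
  have hq0 : 0 ≤ (∑' y, ω x y) / μ x := div_nonneg (tsum_nonneg (hG.nonneg x)) hμ.le
  have hqD : (∑' y, ω x y) / μ x ≤ D := (div_le_iff₀ hμ).mpr (hD x)
  set q := (∑' y, ω x y) / μ x
  have hcC := hc x r hr
  have hmain := hineq x r ⟨hr0, hr.2⟩
  have hcoef : (l + q - c x r) * z x r ≤ (2 * D + 1) * z x r :=
    mul_le_mul_of_nonpos_right (by linarith) hz.le
  have hqE : q * E ≤ D * E := mul_le_mul_of_nonneg_right hqD hE0
  have hDz : (2 * D + 1) * z x r < (2 * D + 1) * -(E / 2) :=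
    mul_lt_mul_of_pos_left hzE (by linarith)
  linarith

/-- Lemma 3.2 (discrete Phragmén–Lindelöf principle): on an infinite locally
finite connected graph with `D_μ < ∞` and `T ∈ (0,∞]`, if `c` and `z` are
bounded on `V × I` for every bounded interval `I ⊆ [0,T)`, `z` is continuous on
`[0,T)` and differentiable on `(0,T)` in `t`, and
`z_t − Δz − c z ≥ 0` on `V × (0,T)` with `z(·,0) ≥ 0`, then `z ≥ 0` on
`V × (0,T)`. -/
theorem stmt11 {V : Type*} [Infinite V] [Countable V]
    (ω : V → V → ℝ) (μ : V → ℝ) (hG : IsWeightedGraph ω μ) (hD : DmuFinite ω μ)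
    (T : ℝ≥0∞) (hT : 0 < T)
    (c z z' : V → ℝ → ℝ)
    (hbdd : ∀ S : Set ℝ, Bornology.IsBounded S →
      (∀ t ∈ S, 0 ≤ t ∧ ENNReal.ofReal t < T) →
      ∃ C : ℝ, ∀ x, ∀ t ∈ S, |c x t| ≤ C ∧ |z x t| ≤ C)
    (hcont : ∀ x, ContinuousOn (z x) {t : ℝ | 0 ≤ t ∧ ENNReal.ofReal t < T})
    (hderiv : ∀ x, ∀ t : ℝ, 0 < t → ENNReal.ofReal t < T →
      HasDerivAt (z x) (z' x t) t)
    (hineq : ∀ x, ∀ t : ℝ, 0 < t → ENNReal.ofReal t < T →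
      0 ≤ z' x t - graphLap ω μ (fun y => z y t) x - c x t * z x t)
    (hinit : ∀ x, 0 ≤ z x 0) :
    ∀ x, ∀ t : ℝ, 0 < t → ENNReal.ofReal t < T → 0 ≤ z x t := by
  intro x s hs hsT
  have hsub : ∀ t ∈ Icc 0 s, 0 ≤ t ∧ ENNReal.ofReal t < T := fun t ht =>
    ⟨ht.1, (ENNReal.ofReal_le_ofReal ht.2).trans_lt hsT⟩
  obtain ⟨C, hC⟩ := hbdd (Icc 0 s) (Metric.isBounded_Icc 0 s) hsub
  obtain ⟨D, hD⟩ := hD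
  have hC0 : 0 ≤ C := (abs_nonneg _).trans (hC x s ⟨hs.le, le_rfl⟩).1
  have hD' : ∀ x, (∑' y, ω x y) ≤ |D| * μ x := fun x =>
    (hD x).trans (mul_le_mul_of_nonneg_right (le_abs_self D) (hG.measurePos x).le)
  have hiter (n : ℕ) : ∀ x, ∀ t ∈ Icc 0 s,
      -(C * (1 / 2) ^ n) ≤ Real.exp (-(C + 2 * |D| + 1) * t) * z x t := by
    induction n with
    | zero =>
      intro x t ht
      have hexp : Real.exp (-(C + 2 * |D| + 1) * t) ≤ 1 := by
        rw [Real.exp_le_one_iff, neg_mul, neg_nonpos]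
        exact mul_nonneg (by positivity) ht.1
      have hz := (abs_le.mp (hC x t ht).2).1
      have := Real.exp_pos (-(C + 2 * |D| + 1) * t)
      nlinarith
    | succ n ih =>
      have h := hG.halve_lower_bound (abs_nonneg D) hD'
        (fun x t ht => (le_abs_self _).trans (hC x t ht).1)
        (fun x => (hcont x).mono hsub)
        (fun x t ht => hderiv x t ht.1 (hsub t ⟨ht.1.le, ht.2⟩).2)
        (fun x t ht => hineq x t ht.1 (hsub t ⟨ht.1.le, ht.2⟩).2)
        hinit (by positivity) ih
      intro x t ht
      convert h x t ht using 1
      ring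
  have hlim : Tendsto (fun n : ℕ => -(C * (1 / 2 : ℝ) ^ n)) atTop (𝓝 0) := by
    simpa using ((tendsto_pow_atTop_nhds_zero_of_lt_one (r := (1 / 2 : ℝ))
      (by norm_num) (by norm_num)).const_mul C).neg
  have h0 := le_of_tendsto' hlim fun n => hiter n x s ⟨hs.le, le_rfl⟩
  exact nonneg_of_mul_nonneg_right h0 (Real.exp_pos _)
end
end

section
/- Let G=(V,E,ω,μ) be an infinite, locally finite, connected weighted graph with D_μ<∞, let T>0, let ψ:V→ℝ, and let f:V×[0,T]×ℝ→ℝ. Let ū and u̲ be bounded upper and lower solutions, respectively, of the problem u_t − Δu = f(x,t,u) on V×(0,T], u(·,0)=ψ. Set η̲ = inf_{V×[0,T]} min{ū,u̲} and η̄ = sup_{V×[0,T]} max{ū,u̲}. If there is M>0 such that |f(x,t,u) − f(x,t,v)| ≤ M|u−v| for all (x,t)∈V×[0,T] and all u,v∈[η̲,η̄], then ū ≥ u̲ on V×[0,T]. -/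
open Filter Topology Set
open scoped ENNReal Classical

noncomputable section

/-- An upper solution of `u_t − Δu = f(x,t,u)` on `V × (0,T]`, `u(·,0) = ψ`,
with time derivative `u'`: bounded, continuous in `t` on `[0,T]`,
differentiable in `t` on `(0,T]`, with `u_t − Δu ≥ f(x,t,u)` and
`u(·,0) ≥ ψ`. -/
def IsUpperSol {V : Type*} (ω : V → V → ℝ) (μ : V → ℝ) (f : V → ℝ → ℝ → ℝ)
    (ψ : V → ℝ) (T : ℝ) (u u' : V → ℝ → ℝ) : Prop :=
  (∃ C : ℝ, ∀ x, ∀ t ∈ Icc (0:ℝ) T, |u x t| ≤ C) ∧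
  (∀ x, ContinuousOn (u x) (Icc (0:ℝ) T)) ∧
  (∀ x, ∀ t ∈ Ioc (0:ℝ) T, HasDerivWithinAt (u x) (u' x t) (Icc (0:ℝ) T) t) ∧
  (∀ x, ∀ t ∈ Ioc (0:ℝ) T, f x t (u x t) ≤ u' x t - graphLap ω μ (fun y => u y t) x) ∧
  (∀ x, ψ x ≤ u x 0)

/-- A lower solution of `u_t − Δu = f(x,t,u)` on `V × (0,T]`, `u(·,0) = ψ`. -/
def IsLowerSol {V : Type*} (ω : V → V → ℝ) (μ : V → ℝ) (f : V → ℝ → ℝ → ℝ)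
    (ψ : V → ℝ) (T : ℝ) (u u' : V → ℝ → ℝ) : Prop :=
  (∃ C : ℝ, ∀ x, ∀ t ∈ Icc (0:ℝ) T, |u x t| ≤ C) ∧
  (∀ x, ContinuousOn (u x) (Icc (0:ℝ) T)) ∧
  (∀ x, ∀ t ∈ Ioc (0:ℝ) T, HasDerivWithinAt (u x) (u' x t) (Icc (0:ℝ) T) t) ∧
  (∀ x, ∀ t ∈ Ioc (0:ℝ) T, u' x t - graphLap ω μ (fun y => u y t) x ≤ f x t (u x t)) ∧
  (∀ x, u x 0 ≤ ψ x)

theorem IsWeightedGraph.finite_support {V : Type*} {ω : V → V → ℝ} {μ : V → ℝ}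
    (hG : IsWeightedGraph ω μ) (x : V) : (Function.support (ω x)).Finite :=
  (hG.locallyFinite x).subset fun y hy => lt_of_le_of_ne (hG.nonneg x y) (Ne.symm hy)

theorem IsWeightedGraph.summable_mul {V : Type*} {ω : V → V → ℝ} {μ : V → ℝ}
    (hG : IsWeightedGraph ω μ) (x : V) (g : V → ℝ) : Summable fun y => ω x y * g y :=
  summable_of_hasFiniteSupport <| (hG.finite_support x).subset fun _ hy => left_ne_zero_of_mul hy

theorem graphLap_sub {V : Type*} {ω : V → V → ℝ} {μ : V → ℝ}
    (hG : IsWeightedGraph ω μ) (u v : V → ℝ) (x : V) :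
    graphLap ω μ (fun y => u y - v y) x = graphLap ω μ u x - graphLap ω μ v x := by
  unfold graphLap
  rw [← mul_sub, ← (hG.summable_mul x _).tsum_sub (hG.summable_mul x _)]
  congr 2
  funext y
  ring

/-- At a vertex where `w` is nonnegative, `Δw` is at most `D_μ` times any nonnegative upper
bound of `w`. -/
theorem graphLap_le_of_le {V : Type*} {ω : V → V → ℝ} {μ : V → ℝ}
    (hG : IsWeightedGraph ω μ) {C S : ℝ} {w : V → ℝ} {x : V}
    (hC : (∑' y, ω x y) ≤ C * μ x) (hS : 0 ≤ S) (hwS : ∀ y, w y ≤ S) (hx : 0 ≤ w x) :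
    graphLap ω μ w x ≤ C * S := by
  have hμ := hG.measurePos x
  have hsum : ∑' y, ω x y * (w y - w x) ≤ (∑' y, ω x y) * S := by
    rw [← tsum_mul_right]
    refine (hG.summable_mul x _).tsum_le_tsum (fun y => ?_) (hG.summable_mul x fun _ => S)
    exact mul_le_mul_of_nonneg_left (by linarith [hwS y]) (hG.nonneg x y)
  unfold graphLap
  rw [one_div, inv_mul_le_iff₀ hμ]
  nlinarith [mul_le_mul_of_nonneg_right hC hS]

/-- A continuous function on `[0, T]` which starts below `B` and has negative derivative wherever
it exceeds `B` stays below `B`. -/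
theorem le_of_deriv_neg_of_gt {T B : ℝ} {v v' : ℝ → ℝ} (hv : ContinuousOn v (Icc 0 T))
    (h0 : v 0 ≤ B) (hd : ∀ t ∈ Ioc 0 T, HasDerivWithinAt v (v' t) (Icc 0 T) t)
    (hneg : ∀ t ∈ Ioc 0 T, B < v t → v' t < 0) :
    ∀ t ∈ Icc 0 T, v t ≤ B := by
  intro t ht
  obtain ⟨s, hs, hmax⟩ := isCompact_Icc.exists_isMaxOn ⟨t, ht⟩ hv
  by_contra! hlt
  have hBs : B < v s := hlt.trans_le (hmax ht)
  have hs0 : 0 < s := hs.1.lt_of_ne fun h => absurd h0 (not_le.2 (h ▸ hBs))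
  have hs' : s ∈ Ioc 0 T := ⟨hs0, hs.2⟩
  have h0mem : (0 : ℝ) ∈ Icc 0 T := ⟨le_rfl, hs.1.trans hs.2⟩
  have hcone : (0 - s : ℝ) ∈ posTangentConeAt (Icc 0 T) s :=
    sub_mem_posTangentConeAt_of_segment_subset ((convex_Icc 0 T).segment_subset hs h0mem)
  have key := hmax.localize.hasFDerivWithinAt_nonpos (hd s hs').hasFDerivWithinAt hcone
  simp only [ContinuousLinearMap.toSpanSingleton_apply, smul_eq_mul] at key
  nlinarith [hneg s hs' hBs]

/-- Maximum principle: a bounded function with `w(·,0) ≤ 0` and `w_t ≤ Δw + M w` wherever `w > 0`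
is nonpositive. -/
theorem nonpos_of_deriv_le_graphLap_add {V : Type*} {ω : V → V → ℝ} {μ : V → ℝ}
    (hG : IsWeightedGraph ω μ) (hD : DmuFinite ω μ) {T M K : ℝ} {w w' : V → ℝ → ℝ}
    (hM : 0 ≤ M) (hK : ∀ x, ∀ t ∈ Icc (0 : ℝ) T, w x t ≤ K)
    (hcont : ∀ x, ContinuousOn (w x) (Icc 0 T))
    (hderiv : ∀ x, ∀ t ∈ Ioc (0 : ℝ) T, HasDerivWithinAt (w x) (w' x t) (Icc 0 T) t)
    (hle : ∀ x, ∀ t ∈ Ioc (0 : ℝ) T, 0 < w x t →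
      w' x t ≤ graphLap ω μ (fun y => w y t) x + M * w x t)
    (h0 : ∀ x, w x 0 ≤ 0) :
    ∀ x, ∀ t ∈ Icc (0 : ℝ) T, w x t ≤ 0 := by
  obtain ⟨C₀, hC₀⟩ := hD
  obtain ⟨C, hCpos, hC⟩ : ∃ C : ℝ, 0 < C ∧ ∀ x, (∑' y, ω x y) ≤ C * μ x := by
    refine ⟨max C₀ 1, by positivity, fun x => (hC₀ x).trans ?_⟩
    exact mul_le_mul_of_nonneg_right (le_max_left _ _) (hG.measurePos x).le
  set r : ℝ := M + 2 * C with hr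
  have hexp : ∀ x t, w x t = Real.exp (r * t) * (Real.exp (-(r * t)) * w x t) := fun x t => by
    rw [← mul_assoc, ← Real.exp_add]; simp
  have half : ∀ S : ℝ, 0 ≤ S → (∀ x, ∀ t ∈ Icc (0 : ℝ) T, Real.exp (-(r * t)) * w x t ≤ S) →
      ∀ x, ∀ t ∈ Icc (0 : ℝ) T, Real.exp (-(r * t)) * w x t ≤ S / 2 := by
    intro S hS hb x
    refine le_of_deriv_neg_of_gt (v' := fun t =>
      Real.exp (-(r * t)) * -r * w x t + Real.exp (-(r * t)) * w' x t) ?_ ?_ ?_ ?_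
    · exact (Continuous.continuousOn (by fun_prop)).mul (hcont x)
    · simpa using (h0 x).trans (by positivity)
    · intro t ht
      have h1 : HasDerivAt (fun t : ℝ => Real.exp (-(r * t))) (Real.exp (-(r * t)) * -r) t := by
        simpa using ((hasDerivAt_id t).const_mul r).neg.exp
      exact h1.hasDerivWithinAt.mul (hderiv x t ht)
    · intro t ht hgt
      have hE := Real.exp_pos (-(r * t))
      have hw : 0 < w x t := pos_of_mul_pos_right ((by positivity : 0 ≤ S / 2).trans_lt hgt) hE.le
      have hlap : graphLap ω μ (fun y => w y t) x ≤ C * (Real.exp (r * t) * S) := by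
        refine graphLap_le_of_le hG (hC x) (by positivity) (fun y => ?_) hw.le
        rw [hexp y t]
        exact mul_le_mul_of_nonneg_left (hb y t ⟨ht.1.le, ht.2⟩) (Real.exp_pos _).le
      have hEE : Real.exp (-(r * t)) * Real.exp (r * t) = 1 := by
        rw [← Real.exp_add]; simp
      have h3 : Real.exp (-(r * t)) * w' x t ≤
          C * S + M * (Real.exp (-(r * t)) * w x t) := by
        calc Real.exp (-(r * t)) * w' x t
            ≤ Real.exp (-(r * t)) * (C * (Real.exp (r * t) * S) + M * w x t) :=
              mul_le_mul_of_nonneg_left ((hle x t ht hw).trans (by linarith)) hE.le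
          _ = C * S * (Real.exp (-(r * t)) * Real.exp (r * t))
              + M * (Real.exp (-(r * t)) * w x t) := by ring
          _ = _ := by rw [hEE, mul_one]
      have h4 : C * (S / 2) < C * (Real.exp (-(r * t)) * w x t) :=
        mul_lt_mul_of_pos_left hgt hCpos
      have h5 : Real.exp (-(r * t)) * -r * w x t =
          -(M * (Real.exp (-(r * t)) * w x t)) - 2 * (C * (Real.exp (-(r * t)) * w x t)) := by
        rw [hr]; ring
      linarith
  have iter : ∀ n : ℕ, ∀ x, ∀ t ∈ Icc (0 : ℝ) T,
      Real.exp (-(r * t)) * w x t ≤ |K| * (1 / 2) ^ n := by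
    intro n
    induction n with
    | zero =>
      intro x t ht
      have h1 : Real.exp (-(r * t)) ≤ 1 :=
        Real.exp_le_one_iff.2 (by have := mul_nonneg (by positivity : 0 ≤ r) ht.1; linarith)
      calc Real.exp (-(r * t)) * w x t ≤ Real.exp (-(r * t)) * |K| :=
            mul_le_mul_of_nonneg_left ((hK x t ht).trans (le_abs_self K)) (Real.exp_pos _).le
        _ ≤ 1 * |K| := mul_le_mul_of_nonneg_right h1 (abs_nonneg K)
        _ = |K| * (1 / 2) ^ 0 := by ring
    | succ n ih =>
      intro x t ht
      exact (half _ (by positivity) ih x t ht).trans_eq (by ring)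
  intro x t ht
  have hlim : Tendsto (fun n : ℕ => |K| * (1 / 2 : ℝ) ^ n) atTop (𝓝 0) := by
    simpa using (tendsto_pow_atTop_nhds_zero_of_lt_one (r := (1 / 2 : ℝ))
      (by norm_num) (by norm_num)).const_mul |K|
  have := ge_of_tendsto' hlim fun n => iter n x t ht
  exact nonpos_of_mul_nonpos_right this (Real.exp_pos _)

/-- Lemma 3.4 (ordering of upper and lower solutions): if `D_μ < ∞`, `ū` and
`u̲` are bounded upper and lower solutions and `f` is Lipschitz in `u` on
`[η̲, η̄]` (with `η̲ = inf min{ū,u̲}` and `η̄ = sup max{ū,u̲}` over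
`V × [0,T]`), then `u̲ ≤ ū` on `V × [0,T]`. -/
theorem stmt12 {V : Type*} [Infinite V] [Countable V]
    (ω : V → V → ℝ) (μ : V → ℝ) (hG : IsWeightedGraph ω μ) (hD : DmuFinite ω μ)
    (T : ℝ) (hT : 0 < T)
    (ψ : V → ℝ) (f : V → ℝ → ℝ → ℝ)
    (ub lb ub' lb' : V → ℝ → ℝ)
    (hub : IsUpperSol ω μ f ψ T ub ub') (hlb : IsLowerSol ω μ f ψ T lb lb')
    (M : ℝ) (hM : 0 < M)
    (hLip : ∀ x, ∀ t ∈ Icc (0:ℝ) T,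
      ∀ a ∈ Icc (sInf {r : ℝ | ∃ x', ∃ t' ∈ Icc (0:ℝ) T, r = min (ub x' t') (lb x' t')})
               (sSup {r : ℝ | ∃ x', ∃ t' ∈ Icc (0:ℝ) T, r = max (ub x' t') (lb x' t')}),
      ∀ b ∈ Icc (sInf {r : ℝ | ∃ x', ∃ t' ∈ Icc (0:ℝ) T, r = min (ub x' t') (lb x' t')})
               (sSup {r : ℝ | ∃ x', ∃ t' ∈ Icc (0:ℝ) T, r = max (ub x' t') (lb x' t')}),
        |f x t a - f x t b| ≤ M * |a - b|) :
    ∀ x, ∀ t ∈ Icc (0:ℝ) T, lb x t ≤ ub x t := by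
  obtain ⟨⟨A, hA⟩, hucont, huderiv, huineq, hu0⟩ := hub
  obtain ⟨⟨B, hB⟩, hlcont, hlderiv, hlineq, hl0⟩ := hlb
  have hbelow : BddBelow {r : ℝ | ∃ x', ∃ t' ∈ Icc (0:ℝ) T, r = min (ub x' t') (lb x' t')} := by
    refine ⟨min (-A) (-B), ?_⟩
    rintro _ ⟨x, t, ht, rfl⟩
    exact min_le_min (abs_le.1 (hA x t ht)).1 (abs_le.1 (hB x t ht)).1
  have habove : BddAbove {r : ℝ | ∃ x', ∃ t' ∈ Icc (0:ℝ) T, r = max (ub x' t') (lb x' t')} := by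
    refine ⟨max A B, ?_⟩
    rintro _ ⟨x, t, ht, rfl⟩
    exact max_le_max (abs_le.1 (hA x t ht)).2 (abs_le.1 (hB x t ht)).2
  intro x t ht
  refine sub_nonpos.1 (nonpos_of_deriv_le_graphLap_add hG hD (K := B + A)
    (w := fun x t => lb x t - ub x t) (w' := fun x t => lb' x t - ub' x t) hM.le ?_
    (fun x => (hlcont x).sub (hucont x)) (fun x t ht => (hlderiv x t ht).sub (huderiv x t ht))
    ?_ (fun x => sub_nonpos.2 ((hl0 x).trans (hu0 x))) x t ht)
  · intro x t ht
    linarith [(abs_le.1 (hA x t ht)).1, (abs_le.1 (hB x t ht)).2]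
  · intro x t ht hpos
    have ht' : t ∈ Icc (0:ℝ) T := ⟨ht.1.le, ht.2⟩
    have hinf := csInf_le hbelow ⟨x, t, ht', rfl⟩
    have hsup := le_csSup habove ⟨x, t, ht', rfl⟩
    have hf := hLip x t ht' (lb x t)
      ⟨hinf.trans (min_le_right _ _), (le_max_right _ _).trans hsup⟩ (ub x t)
      ⟨hinf.trans (min_le_left _ _), (le_max_left _ _).trans hsup⟩
    rw [abs_of_pos hpos] at hf
    rw [graphLap_sub hG (fun y => lb y t) (fun y => ub y t) x]
    linarith [huineq x t ht, hlineq x t ht, le_abs_self (f x t (lb x t) - f x t (ub x t))]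
end
end
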